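/- arXiv:math/0608278 — 2 statements merged into one kernel-verified Lean document; each statement's English description precedes it below -/
import Mathlib

section
/- Let 1 ≤ t < m−1. An isometry of F^n preserves Ω(A^t) if and only if it preserves Θ(A^t); moreover, an isometry g(x) = z + π(x) (z ∈ F^n, π a coordinate permutation) satisfies g(Ω(A^t)) = Ω(A^t) if and only if z ∈ Θ(A^t) and π maps each column of the 2^t × 2^{m−t} array onto a column (i.e., there is a permutation ψ of the column indices such that π maps the set of positions of column j onto the set of positions of column ψ(j) for every j). -/
open Finset Pointwise

abbrev Word (n : ℕ) := Fin n → ZMod 2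

def FEv (n : ℕ) : Set (Word n) := {x | Even (hammingNorm x)}

def FOd (n : ℕ) : Set (Word n) := {x | ¬ Even (hammingNorm x)}

def nbr {n : ℕ} (S : Set (Word n)) : Set (Word n) := {y | ∃ x ∈ S, hammingDist y x = 1}

def theta {n : ℕ} (G : Set (Word n)) : Set (Word n) :=
  {x | Even (hammingNorm x) ∧ nbr {x} ⊆ nbr G}

def ExtPerfect {n : ℕ} (C : Set (Word n)) : Prop :=
  C ⊆ FEv n ∧ (∀ x ∈ C, ∀ y ∈ C, x ≠ y → Disjoint (nbr {x}) (nbr {y})) ∧ nbr C = FOd n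

def IsIsometry {n : ℕ} (g : Word n → Word n) : Prop :=
  Function.Bijective g ∧ ∀ x y, hammingDist (g x) (g y) = hammingDist x y

def embWord (m t : ℕ) (v : Word (2 ^ (m - t))) : Word (2 ^ m) := fun i =>
  if h : (i : ℕ) < 2 ^ (m - t) then v ⟨i, h⟩
  else if h2 : (i : ℕ) < 2 * 2 ^ (m - t) then v ⟨(i : ℕ) - 2 ^ (m - t), by omega⟩
  else 0

def Vt (m t : ℕ) : Set (Word (2 ^ m)) :=
  {x | ∃ v : Word (2 ^ (m - t)), Even (hammingNorm v) ∧ x = embWord m t v}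

def At (m : ℕ) : ℕ → Set (Word (2 ^ m))
  | 0 => {0}
  | 1 => Vt m 1
  | t + 2 => Vt m (t + 2) + At m (t + 1)

def IsComp (m t : ℕ) (G : Set (Word (2 ^ m))) : Prop :=
  G ⊆ FEv (2 ^ m) ∧ G.ncard = (At m t).ncard ∧ nbr G = nbr (At m t)

def IsMuComp (m t : ℕ) (μ : Word (2 ^ m)) (M : Set (Word (2 ^ m))) : Prop :=
  (∀ i : Fin (2 ^ m), 2 ^ (m - t) ≤ (i : ℕ) → μ i = 0) ∧
  ∃ G, IsComp m t G ∧ M = (fun x => μ + x) '' G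

def arrEntry (m t : ℕ) (x : Word (2 ^ m)) (i : Fin (2 ^ t)) (j : Fin (2 ^ (m - t))) : ZMod 2 :=
  x ⟨((i : ℕ) * 2 ^ (m - t) + (j : ℕ)) % 2 ^ m, Nat.mod_lt _ (Nat.two_pow_pos m)⟩

def pchk (m t : ℕ) (x : Word (2 ^ m)) : Word (2 ^ (m - t)) :=
  fun j => ∑ i : Fin (2 ^ t), arrEntry m t x i j

def Bt (m : ℕ) : ℕ → Set (Word (2 ^ m))
  | 0 => Vt m 1
  | 1 => Vt m 1
  | t + 2 => Vt m (t + 2) + theta (At m (t + 1))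

theorem ZMod.eq_add_one_of_ne {a b : ZMod 2} (h : a ≠ b) : a = b + 1 := by
  revert a b
  decide

theorem word_add_self {n : ℕ} (w : Word n) : w + w = 0 :=
  funext fun _ => CharTwo.add_self_eq_zero _

theorem hammingDist_eq_one_iff {n : ℕ} (y x : Word n) :
    hammingDist y x = 1 ↔ ∃ i, y = x + Pi.single i 1 := by
  constructor
  · intro h
    unfold hammingDist at h
    obtain ⟨i, hi⟩ := Finset.card_eq_one.mp h
    refine ⟨i, funext fun l => ?_⟩
    have hl : y l ≠ x l ↔ l = i := by
      simpa using congrArg (l ∈ ·) hi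
    by_cases hli : l = i
    · subst hli
      have h1 := hl.mpr rfl
      simp only [Pi.add_apply, Pi.single_eq_same]
      exact ZMod.eq_add_one_of_ne h1
    · have h1 : y l = x l := by
        by_contra h2
        exact hli (hl.mp h2)
      simp [h1, hli]
  · rintro ⟨i, rfl⟩
    unfold hammingDist
    rw [Finset.card_eq_one]
    refine ⟨i, ?_⟩
    ext l
    by_cases hli : l = i <;> simp [hli]

theorem mem_nbr_iff {n : ℕ} (S : Set (Word n)) (y : Word n) :
    y ∈ nbr S ↔ ∃ x ∈ S, ∃ i, y = x + Pi.single i 1 := by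
  simp only [nbr, Set.mem_ofPred_eq, hammingDist_eq_one_iff]

theorem IsIsometry.image_nbr {n : ℕ} {g : Word n → Word n} (hg : IsIsometry g)
    (S : Set (Word n)) : g '' nbr S = nbr (g '' S) := by
  ext y
  constructor
  · rintro ⟨u, ⟨x, hx, hux⟩, rfl⟩
    exact ⟨g x, ⟨x, hx, rfl⟩, by rw [hg.2, hux]⟩
  · rintro ⟨_, ⟨x, hx, rfl⟩, hy⟩
    obtain ⟨u, rfl⟩ := hg.1.2 y
    exact ⟨u, ⟨x, hx, by rw [← hg.2, hy]⟩, rfl⟩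

theorem cast_hammingNorm {n : ℕ} (x : Word n) : ((hammingNorm x : ℕ) : ZMod 2) = ∑ i, x i := by
  unfold hammingNorm
  rw [← Finset.sum_boole]
  refine Finset.sum_congr rfl fun i _ => ?_
  by_cases h : x i = 0
  · simp [h]
  · simpa [h] using (ZMod.eq_add_one_of_ne h).symm

theorem even_hammingNorm_iff {n : ℕ} (x : Word n) :
    Even (hammingNorm x) ↔ ∑ i, x i = 0 := by
  rw [← cast_hammingNorm, ZMod.natCast_eq_zero_iff_even]

/-- The column of a position in the array with rows of length `2 ^ k`. -/
def colIdx (m k : ℕ) (i : Fin (2 ^ m)) : Fin (2 ^ k) :=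
  ⟨(i : ℕ) % 2 ^ k, Nat.mod_lt _ (Nat.two_pow_pos k)⟩

/-- The vector of column parities in the array with rows of length `2 ^ k`. -/
def colParity (m k : ℕ) (x : Word (2 ^ m)) : Word (2 ^ k) :=
  fun j => ∑ i with colIdx m k i = j, x i

theorem colParity_add (m k : ℕ) (x y : Word (2 ^ m)) :
    colParity m k (x + y) = colParity m k x + colParity m k y := by
  funext j
  simp [colParity, Finset.sum_add_distrib]

theorem colParity_zero (m k : ℕ) : colParity m k 0 = 0 := by
  funext j
  simp [colParity]

theorem colParity_single (m k : ℕ) (i : Fin (2 ^ m)) :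
    colParity m k (Pi.single i 1) = Pi.single (colIdx m k i) 1 := by
  funext j
  simp only [colParity, Finset.sum_filter, Pi.single_apply]
  rw [Finset.sum_eq_single i]
  · simp [eq_comm]
  · intro b _ hb
    simp [hb]
  · simp

theorem colIdx_surjective {m k : ℕ} (hk : k ≤ m) : Function.Surjective (colIdx m k) := fun j =>
  ⟨⟨j, j.2.trans_le (Nat.pow_le_pow_right two_pos hk)⟩, Fin.ext (Nat.mod_eq_of_lt j.2)⟩

theorem sum_colParity (m k : ℕ) (x : Word (2 ^ m)) : ∑ j, colParity m k x j = ∑ i, x i := by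
  simp only [colParity]
  exact Finset.sum_fiberwise _ _ _

/-- The position in the first half of a row of length `2 ^ (k + 1)`. -/
def lowHalf {k : ℕ} (j : Fin (2 ^ k)) : Fin (2 ^ (k + 1)) :=
  ⟨j, by have := j.2; rw [pow_succ]; omega⟩

/-- The position in the second half of a row of length `2 ^ (k + 1)`. -/
def highHalf {k : ℕ} (j : Fin (2 ^ k)) : Fin (2 ^ (k + 1)) :=
  ⟨j + 2 ^ k, by have := j.2; rw [pow_succ]; omega⟩

theorem eq_lowHalf_or_highHalf {k : ℕ} (l : Fin (2 ^ (k + 1))) :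
    ∃ j : Fin (2 ^ k), l = lowHalf j ∨ l = highHalf j := by
  have hl := l.2
  have hp := pow_succ 2 k
  by_cases h : (l : ℕ) < 2 ^ k
  · exact ⟨⟨l, h⟩, Or.inl rfl⟩
  · exact ⟨⟨l - 2 ^ k, by omega⟩, Or.inr (Fin.ext (by simp [highHalf]; omega))⟩

theorem lowHalf_ne_highHalf {k : ℕ} (i j : Fin (2 ^ k)) : lowHalf i ≠ highHalf j := by
  intro h
  have := congrArg Fin.val h
  simp only [lowHalf, highHalf] at this
  omega

theorem lowHalf_inj {k : ℕ} {i j : Fin (2 ^ k)} : lowHalf i = lowHalf j ↔ i = j := by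
  simp [lowHalf, Fin.ext_iff]

theorem highHalf_inj {k : ℕ} {i j : Fin (2 ^ k)} : highHalf i = highHalf j ↔ i = j := by
  simp [highHalf, Fin.ext_iff]

theorem colIdx_eq_iff (m k : ℕ) (i : Fin (2 ^ m)) (j : Fin (2 ^ k)) :
    colIdx m k i = j ↔ colIdx m (k + 1) i = lowHalf j ∨ colIdx m (k + 1) i = highHalf j := by
  have h1 : (i : ℕ) % 2 ^ (k + 1) = i % 2 ^ k + 2 ^ k * (i / 2 ^ k % 2) := by
    rw [pow_succ, Nat.mod_mul]
  have h2 : (i : ℕ) % 2 ^ k < 2 ^ k := Nat.mod_lt _ (Nat.two_pow_pos k)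
  have hj := j.2
  simp only [colIdx, lowHalf, highHalf, Fin.ext_iff, h1]
  rcases Nat.mod_two_eq_zero_or_one ((i : ℕ) / 2 ^ k) with h | h <;> rw [h] <;> omega

theorem colParity_eq_add (m k : ℕ) (x : Word (2 ^ m)) (j : Fin (2 ^ k)) :
    colParity m k x j
      = colParity m (k + 1) x (lowHalf j) + colParity m (k + 1) x (highHalf j) := by
  simp only [colParity, Finset.sum_filter, ← Finset.sum_add_distrib]
  refine Finset.sum_congr rfl fun i _ => ?_
  rw [if_congr (colIdx_eq_iff m k i j) rfl rfl]
  by_cases h1 : colIdx m (k + 1) i = lowHalf j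
  · simp [h1, lowHalf_ne_highHalf]
  · simp [h1]

theorem colParity_embWord_lowHalf {m t : ℕ} (ht : t + 1 ≤ m) (v : Word (2 ^ (m - (t + 1))))
    (j : Fin (2 ^ (m - (t + 1)))) :
    colParity m (m - (t + 1) + 1) (embWord m (t + 1) v) (lowHalf j) = v j := by
  have hle : 2 ^ (m - (t + 1) + 1) ≤ 2 ^ m := Nat.pow_le_pow_right two_pos (by omega)
  have hp := pow_succ 2 (m - (t + 1))
  have hj := j.2
  simp only [colParity, Finset.sum_filter]
  rw [Finset.sum_eq_single ⟨j, by omega⟩]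
  · have : (j : ℕ) % 2 ^ (m - (t + 1) + 1) = j := Nat.mod_eq_of_lt (by omega)
    simp [colIdx, lowHalf, embWord, this]
  · intro i _ hi
    split_ifs with h
    · have h1 : (i : ℕ) % 2 ^ (m - (t + 1) + 1) = j := congrArg Fin.val h
      have h2 : ¬ (i : ℕ) < 2 ^ (m - (t + 1) + 1) := fun h3 => by
        rw [Nat.mod_eq_of_lt h3] at h1
        exact hi (Fin.ext h1)
      unfold embWord
      rw [dif_neg (by omega), dif_neg (by omega)]
    · rfl
  · simp

theorem colParity_embWord_highHalf {m t : ℕ} (ht : t + 1 ≤ m) (v : Word (2 ^ (m - (t + 1))))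
    (j : Fin (2 ^ (m - (t + 1)))) :
    colParity m (m - (t + 1) + 1) (embWord m (t + 1) v) (highHalf j) = v j := by
  have hle : 2 ^ (m - (t + 1) + 1) ≤ 2 ^ m := Nat.pow_le_pow_right two_pos (by omega)
  have hp := pow_succ 2 (m - (t + 1))
  have hj := j.2
  simp only [colParity, Finset.sum_filter]
  rw [Finset.sum_eq_single ⟨j + 2 ^ (m - (t + 1)), by omega⟩]
  · have : ((j : ℕ) + 2 ^ (m - (t + 1))) % 2 ^ (m - (t + 1) + 1) = j + 2 ^ (m - (t + 1)) :=
      Nat.mod_eq_of_lt (by omega)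
    have h2 : (j : ℕ) + 2 ^ (m - (t + 1)) < 2 * 2 ^ (m - (t + 1)) := by omega
    simp [colIdx, highHalf, embWord, this, h2]
  · intro i _ hi
    split_ifs with h
    · have h1 : (i : ℕ) % 2 ^ (m - (t + 1) + 1) = j + 2 ^ (m - (t + 1)) := congrArg Fin.val h
      have h2 : ¬ (i : ℕ) < 2 ^ (m - (t + 1) + 1) := fun h3 => by
        rw [Nat.mod_eq_of_lt h3] at h1
        exact hi (Fin.ext h1)
      unfold embWord
      rw [dif_neg (by omega), dif_neg (by omega)]
    · rfl
  · simp

theorem At_succ (m t : ℕ) : At m (t + 1) = Vt m (t + 1) + At m t := by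
  cases t with
  | zero => simp [At]
  | succ t => rfl

theorem colParity_of_mem_At {m t : ℕ} (ht : t ≤ m) {x : Word (2 ^ m)} (hx : x ∈ At m t) :
    colParity m (m - t) x = 0 := by
  induction t generalizing x with
  | zero =>
    rw [show x = 0 from hx, colParity_zero]
  | succ t ih =>
    rw [At_succ] at hx
    obtain ⟨_, ⟨v, -, rfl⟩, u, hu, rfl⟩ := hx
    have hk : m - t = m - (t + 1) + 1 := by omega
    have h0 := ih (by omega) hu
    rw [hk] at h0
    funext j
    change colParity m (m - (t + 1)) (embWord m (t + 1) v + u) j = 0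
    rw [colParity_eq_add, colParity_add, h0]
    simp [colParity_embWord_lowHalf ht, colParity_embWord_highHalf ht, CharTwo.add_self_eq_zero]

theorem exists_even_sub_eq_single {k : ℕ} (w : Word (2 ^ (k + 1))) (j : Fin (2 ^ k))
    (h : ∀ l, w (lowHalf l) + w (highHalf l) = (Pi.single j 1 : Word (2 ^ k)) l) :
    ∃ v : Word (2 ^ k), Even (hammingNorm v) ∧ ∃ j', ∀ l,
      w (lowHalf l) = v l + (Pi.single j' 1 : Word (2 ^ (k + 1))) (lowHalf l) ∧
      w (highHalf l) = v l + (Pi.single j' 1 : Word (2 ^ (k + 1))) (highHalf l) := by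
  have h' : ∀ l, w (highHalf l) = w (lowHalf l) + (Pi.single j 1 : Word (2 ^ k)) l := fun l => by
    rw [← h l, ← add_assoc, CharTwo.add_self_eq_zero, zero_add]
  by_cases he : ∑ l, w (lowHalf l) = 0
  · refine ⟨fun l => w (lowHalf l), (even_hammingNorm_iff _).mpr he, highHalf j, fun l => ?_⟩
    rw [h']
    simp [Pi.single_apply, lowHalf_ne_highHalf, highHalf_inj]
  · refine ⟨fun l => w (highHalf l), (even_hammingNorm_iff _).mpr ?_, lowHalf j, fun l => ?_⟩
    · simp only [h', Finset.sum_add_distrib, Finset.sum_pi_single', Finset.mem_univ, if_true]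
      rw [ZMod.eq_add_one_of_ne he, zero_add, CharTwo.add_self_eq_zero]
    · simp only [h']
      simp [Pi.single_apply, (lowHalf_ne_highHalf _ _).symm, lowHalf_inj, add_assoc,
        CharTwo.add_self_eq_zero]

theorem mem_nbr_At_iff {m t : ℕ} (ht : t ≤ m) (y : Word (2 ^ m)) :
    y ∈ nbr (At m t) ↔ ∃ j, colParity m (m - t) y = Pi.single j 1 := by
  constructor
  · rw [mem_nbr_iff]
    rintro ⟨x, hx, i, rfl⟩
    exact ⟨colIdx m (m - t) i, by
      rw [colParity_add, colParity_of_mem_At ht hx, colParity_single, zero_add]⟩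
  · induction t generalizing y with
    | zero =>
      rintro ⟨j, hj⟩
      rw [mem_nbr_iff]
      refine ⟨0, rfl, j, ?_⟩
      rw [zero_add]
      rw [← hj]
      funext i
      simp only [colParity, Nat.sub_zero, Finset.sum_filter]
      rw [Finset.sum_eq_single i]
      · simp [colIdx, Nat.mod_eq_of_lt i.2]
      · intro b _ hb
        have : colIdx m m b = b := Fin.ext (Nat.mod_eq_of_lt b.2)
        simp [this, hb]
      · simp
    | succ t ih =>
      rintro ⟨j, hj⟩
      have hk : m - t = m - (t + 1) + 1 := by omega
      have ih' := ih (by omega)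
      rw [hk] at ih'
      obtain ⟨v, hv, j', hj'⟩ := exists_even_sub_eq_single (colParity m (m - (t + 1) + 1) y) j
        fun l => by rw [← colParity_eq_add, hj]
      have hmem : embWord m (t + 1) v + y ∈ nbr (At m t) := by
        refine ih' _ ⟨j', funext fun l => ?_⟩
        rw [colParity_add, Pi.add_apply]
        obtain ⟨i, rfl | rfl⟩ := eq_lowHalf_or_highHalf l
        · rw [colParity_embWord_lowHalf ht, (hj' i).1, ← add_assoc, CharTwo.add_self_eq_zero,
            zero_add]
        · rw [colParity_embWord_highHalf ht, (hj' i).2, ← add_assoc, CharTwo.add_self_eq_zero,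
            zero_add]
      rw [mem_nbr_iff] at hmem ⊢
      obtain ⟨x, hx, i, hi⟩ := hmem
      refine ⟨embWord m (t + 1) v + x, ?_, i, ?_⟩
      · rw [At_succ]
        exact Set.add_mem_add ⟨v, hv, rfl⟩ hx
      · rw [add_assoc, ← hi, ← add_assoc, CharTwo.add_self_eq_zero, zero_add]

theorem nbr_singleton_subset_iff {m t : ℕ} (ht : t ≤ m) (x : Word (2 ^ m)) :
    nbr {x} ⊆ nbr (At m t) ↔
      ∀ j, ∃ j', colParity m (m - t) x + Pi.single j 1 = Pi.single j' 1 := by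
  constructor
  · intro h j
    obtain ⟨i, rfl⟩ := colIdx_surjective (Nat.sub_le m t) j
    have := h ((mem_nbr_iff _ _).mpr ⟨x, rfl, i, rfl⟩)
    rwa [mem_nbr_At_iff ht, colParity_add, colParity_single] at this
  · intro h y hy
    obtain ⟨_, rfl, i, rfl⟩ := (mem_nbr_iff _ _).mp hy
    rw [mem_nbr_At_iff ht, colParity_add, colParity_single]
    exact h _

theorem eq_zero_of_forall_add_single {n : ℕ} (hn : 2 < n) (w : Word n)
    (h : ∀ j, ∃ j', w + Pi.single j 1 = Pi.single j' 1) : w = 0 := by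
  have h' : ∀ j, ∃ j', w = Pi.single j' 1 + Pi.single j 1 := fun j => by
    obtain ⟨j', hj'⟩ := h j
    exact ⟨j', by rw [← hj', add_assoc, word_add_self, add_zero]⟩
  obtain ⟨a, ha⟩ := h' ⟨0, by omega⟩
  obtain ⟨b, hb0, hba⟩ := Fin.exists_ne_and_ne_of_two_lt (⟨0, by omega⟩ : Fin n) a hn
  obtain ⟨b', hb⟩ := h' b
  have hwb : w b = 0 := by simp [ha, hb0, hba]
  have hbb : b' = b := by
    by_contra hne
    rw [hb] at hwb
    simp [Ne.symm hne] at hwb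
  rw [hb, hbb, word_add_self]

theorem nbr_singleton_subset_iff_colParity {m t : ℕ} (ht : t + 1 < m) (x : Word (2 ^ m)) :
    nbr {x} ⊆ nbr (At m t) ↔ colParity m (m - t) x = 0 := by
  rw [nbr_singleton_subset_iff (by omega)]
  refine ⟨eq_zero_of_forall_add_single ?_ _, fun h j => ⟨j, by rw [h, zero_add]⟩⟩
  calc 2 < 2 ^ 2 := by norm_num
    _ ≤ 2 ^ (m - t) := Nat.pow_le_pow_right two_pos (by omega)

theorem mem_theta_At_iff {m t : ℕ} (ht : t + 1 < m) (x : Word (2 ^ m)) :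
    x ∈ theta (At m t) ↔ colParity m (m - t) x = 0 := by
  change Even (hammingNorm x) ∧ nbr {x} ⊆ nbr (At m t) ↔ _
  rw [nbr_singleton_subset_iff_colParity ht, and_iff_right_iff_imp, even_hammingNorm_iff,
    ← sum_colParity m (m - t)]
  intro h
  simp [h]

theorem nbr_theta_At {m t : ℕ} (ht : t + 1 < m) : nbr (theta (At m t)) = nbr (At m t) := by
  ext y
  rw [mem_nbr_iff]
  constructor
  · rintro ⟨x, hx, i, rfl⟩
    exact hx.2 ((mem_nbr_iff _ _).mpr ⟨x, rfl, i, rfl⟩)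
  · rw [mem_nbr_iff]
    rintro ⟨x, hx, i, rfl⟩
    exact ⟨x, (mem_theta_At_iff ht x).mpr (colParity_of_mem_At (by omega) hx), i, rfl⟩

theorem IsIsometry.image_nbr_At_eq_iff {m t : ℕ} (ht : t + 1 < m)
    {g : Word (2 ^ m) → Word (2 ^ m)} (hg : IsIsometry g) :
    g '' nbr (At m t) = nbr (At m t) ↔ g '' theta (At m t) = theta (At m t) := by
  have hmem : ∀ x, x ∈ theta (At m t) ↔ nbr {x} ⊆ nbr (At m t) := fun x => by
    rw [mem_theta_At_iff ht, nbr_singleton_subset_iff_colParity ht]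
  constructor
  · intro h
    have key : ∀ x, g x ∈ theta (At m t) ↔ x ∈ theta (At m t) := fun x => by
      rw [hmem, hmem, ← Set.image_singleton, ← hg.image_nbr, ← h,
        Set.image_subset_image_iff hg.1.1, h]
    ext y
    obtain ⟨x, rfl⟩ := hg.1.2 y
    rw [hg.1.1.mem_set_image, key]
  · intro h
    rw [← nbr_theta_At ht, hg.image_nbr, h]

theorem isIsometry_add_comp_perm {n : ℕ} (z : Word n) (π : Equiv.Perm (Fin n)) :
    IsIsometry fun x : Word n => z + fun i => x (π i) := by
  refine ⟨⟨fun x y h => ?_, fun y => ?_⟩, fun x y => ?_⟩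
  · funext i
    have := congrFun (add_left_cancel h) (π.symm i)
    simpa using this
  · exact ⟨fun i => (y - z) (π.symm i), by funext i; simp⟩
  · unfold hammingDist
    refine Finset.card_equiv π fun i => ?_
    simp

theorem colParity_comp_perm {m k : ℕ} (π : Equiv.Perm (Fin (2 ^ m)))
    (ψ : Equiv.Perm (Fin (2 ^ k))) (h : ∀ i, colIdx m k (π i) = ψ (colIdx m k i))
    (x : Word (2 ^ m)) (j : Fin (2 ^ k)) :
    colParity m k (fun i => x (π i)) j = colParity m k x (ψ j) := by
  refine Finset.sum_equiv π (fun i => ?_) fun i _ => rfl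
  simp [h]

theorem exists_perm_colIdx {m k : ℕ} (hk : k ≤ m) (π : Equiv.Perm (Fin (2 ^ m)))
    (h : ∀ x, colParity m k x = 0 → colParity m k (fun i => x (π i)) = 0) :
    ∃ ψ : Equiv.Perm (Fin (2 ^ k)), ∀ i, colIdx m k (π i) = ψ (colIdx m k i) := by
  have hcol : ∀ a b, colIdx m k a = colIdx m k b →
      colIdx m k (π.symm a) = colIdx m k (π.symm b) := by
    intro a b hab
    have h1 := h (Pi.single a 1 + Pi.single b 1) (by
      rw [colParity_add, colParity_single, colParity_single, hab, CharTwo.add_self_eq_zero])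
    have h2 : (fun i => (Pi.single a 1 + Pi.single b 1 : Word (2 ^ m)) (π i))
        = Pi.single (π.symm a) 1 + Pi.single (π.symm b) 1 := by
      funext i
      simp [Pi.single_apply, Equiv.eq_symm_apply]
    rw [h2, colParity_add, colParity_single, colParity_single] at h1
    by_contra hne
    have := congrFun h1 (colIdx m k (π.symm a))
    simp [hne] at this
  obtain ⟨s, hs⟩ := (colIdx_surjective hk).hasRightInverse
  have hφ : ∀ i, colIdx m k (π.symm (s (colIdx m k i))) = colIdx m k (π.symm i) := fun i =>
    hcol _ _ (hs _)
  have hsurj : Function.Surjective fun j => colIdx m k (π.symm (s j)) := fun j => by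
    obtain ⟨i, rfl⟩ := colIdx_surjective hk j
    exact ⟨colIdx m k (π i), by simp [hφ]⟩
  refine ⟨(Equiv.ofBijective _ (Finite.surjective_iff_bijective.mp hsurj)).symm, fun i => ?_⟩
  rw [Equiv.eq_symm_apply]
  simp [hφ]

/-- for 1 ≤ t < m-1, an isometry preserves Ω(A^t) iff it preserves Θ(A^t);
moreover, an isometry g(x) = z + π(x) preserves Ω(A^t) iff z ∈ Θ(A^t) and π maps each
column of the 2^t × 2^{m-t} array onto a column. -/
theorem stmt_11 (m t : ℕ) (hm : 4 ≤ m) (ht : 1 ≤ t) (ht' : t < m - 1) :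
    (∀ g : Word (2 ^ m) → Word (2 ^ m), IsIsometry g →
      (g '' nbr (At m t) = nbr (At m t) ↔ g '' theta (At m t) = theta (At m t))) ∧
    (∀ (z : Word (2 ^ m)) (π : Equiv.Perm (Fin (2 ^ m))),
      (fun x : Word (2 ^ m) => z + fun i => x (π i)) '' nbr (At m t) = nbr (At m t) ↔
        (z ∈ theta (At m t) ∧ ∃ ψ : Equiv.Perm (Fin (2 ^ (m - t))),
          ∀ i : Fin (2 ^ m),
            ((π i : ℕ) % 2 ^ (m - t))
              = (ψ ⟨(i : ℕ) % 2 ^ (m - t), Nat.mod_lt _ (Nat.two_pow_pos (m - t))⟩ : ℕ))) := by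
  have ht2 : t + 1 < m := by omega
  refine ⟨fun g hg => hg.image_nbr_At_eq_iff ht2, fun z π => ?_⟩
  have hg := isIsometry_add_comp_perm z π
  rw [hg.image_nbr_At_eq_iff ht2]
  constructor
  · intro h
    have hmem : ∀ x, colParity m (m - t) x = 0 →
        colParity m (m - t) (z + fun i => x (π i)) = 0 := fun x hx => by
      rw [← mem_theta_At_iff ht2, ← h]
      exact ⟨x, (mem_theta_At_iff ht2 x).mpr hx, rfl⟩
    have hz : colParity m (m - t) z = 0 := by
      have := hmem 0 (colParity_zero _ _)
      rwa [show (fun i => (0 : Word (2 ^ m)) (π i)) = 0 from rfl, add_zero] at this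
    refine ⟨(mem_theta_At_iff ht2 z).mpr hz, ?_⟩
    obtain ⟨ψ, hψ⟩ := exists_perm_colIdx (Nat.sub_le m t) π fun x hx => by
      have := hmem x hx
      rwa [colParity_add, hz, zero_add] at this
    exact ⟨ψ, fun i => congrArg Fin.val (hψ i)⟩
  · rintro ⟨hz, ψ, hψ⟩
    rw [mem_theta_At_iff ht2] at hz
    ext y
    obtain ⟨x, rfl⟩ := hg.1.2 y
    rw [hg.1.1.mem_set_image, mem_theta_At_iff ht2, mem_theta_At_iff ht2, colParity_add, hz,
      zero_add]
    have key := colParity_comp_perm π ψ (fun i => Fin.ext (hψ i)) x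
    constructor
    · intro h
      funext j
      rw [key, h]
      rfl
    · intro h
      funext j
      obtain ⟨l, rfl⟩ := ψ.surjective j
      rw [← key, h]
      rfl
end

section
/- Let n = 2^m with m ≥ 4, and let B(n−1) denote the number of 1-perfect binary codes of length n−1. Then B(n−1) ≥ (n!/(6·((n/4)!)^4)) · ∏_{t=1}^{m−2} (D_t^{W_{t+1}} − D_t·W_{t+1})^{E_t}, where D_t = 2·(binom(2^t, 2^{t−1})/2)^{2^{m−t}}, W_i = 2^{2^{m−i}−1} for i = 1,…,m−1, and E_t = ∏_{i=t+2}^{m−1} W_i (with E_{m−2} = 1 as the empty product). -/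
open Finset Pointwise

/-- A 1-perfect binary code of length N: radius-1 balls around codewords partition F^N. -/
def Perfect1 {N : ℕ} (C : Set (Word N)) : Prop :=
  ∀ y : Word N, ∃! x, x ∈ C ∧ hammingDist x y ≤ 1

/-- |𝒟^t| for t < m-1. -/
def Dfac (m t : ℕ) : ℕ := 2 * (Nat.choose (2 ^ t) (2 ^ (t - 1)) / 2) ^ 2 ^ (m - t)

/-- |V^i| = 2^{2^{m-i}-1}. -/
def Wfac (m i : ℕ) : ℕ := 2 ^ (2 ^ (m - i) - 1)

set_option linter.unusedSectionVars false

namespace ColumnCode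

variable {X J : Type} [Fintype X] [DecidableEq X] [Fintype J] [DecidableEq J]

/-- The vector of column parities of `x`, the columns being the fibres of `p`. -/
def par (p : X → J) (x : X → ZMod 2) (j : J) : ZMod 2 := ∑ i with p i = j, x i

/-- All fibres of `q` have exactly `k` elements. -/
def Uniform (q : X → J) (k : ℕ) : Prop := ∀ j, (Finset.univ.filter fun i => q i = j).card = k

/-- `N` consists of words with even columns, and every word with exactly one odd column has
exactly one neighbour in `N`. -/
structure IsColComp (p : X → J) (N : Set (X → ZMod 2)) : Prop where
  even : ∀ x ∈ N, par p x = 0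
  cover : ∀ y j, par p y = Pi.single j 1 → ∃! i, y + Pi.single i 1 ∈ N

/-- The functional `P` takes the value `c` on the component `N`, and any functional constant on `N`
is a combination of `P` and column indicators. -/
structure IsTight (p : X → J) (P : X → ZMod 2) (c : ZMod 2) (N : Set (X → ZMod 2)) : Prop where
  comp : IsColComp p N
  value : ∀ x ∈ N, P ⬝ᵥ x = c
  ann : ∀ Q q, (∀ x ∈ N, Q ⬝ᵥ x = q) → ∃ f : J → ZMod 2, ∃ e, ∀ i, Q i = f (p i) + e * P i

lemma zmod_two_eq_zero_or_one (a : ZMod 2) : a = 0 ∨ a = 1 := by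
  revert a; decide

lemma eq_or_eq_add_one (a b : ZMod 2) : a = b ∨ a = b + 1 := by
  revert a b; decide

lemma word_add_self (x : X → ZMod 2) : x + x = 0 :=
  funext fun i => CharTwo.add_self_eq_zero (x i)

lemma sum_zmod_two {M : Type*} [AddCommMonoid M] (f : ZMod 2 → M) : ∑ b, f b = f 0 + f 1 :=
  Fin.sum_univ_two f

lemma par_add (p : X → J) (x y : X → ZMod 2) : par p (x + y) = par p x + par p y := by
  ext j; simp [par, Finset.sum_add_distrib]

lemma par_single (p : X → J) (i : X) : par p (Pi.single i 1) = Pi.single (p i) 1 := by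
  ext j
  simp [par, Pi.single_apply, eq_comm (a := j)]

lemma dotProduct_comp (p : X → J) (f : J → ZMod 2) (x : X → ZMod 2) :
    (f ∘ p) ⬝ᵥ x = ∑ j, f j * par p x j := by
  rw [dotProduct, ← Finset.sum_fiberwise Finset.univ p]
  refine Finset.sum_congr rfl fun j _ => ?_
  rw [par, Finset.mul_sum]
  refine Finset.sum_congr rfl fun i hi => ?_
  rw [← (Finset.mem_filter.1 hi).2]; rfl

lemma par_fst (p : X → J) (P x : X → ZMod 2) (j : J) :
    par p x j = par (fun i => (p i, P i)) x (j, 0) + par (fun i => (p i, P i)) x (j, 1) := by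
  rw [← sum_zmod_two fun b => par (fun i => (p i, P i)) x (j, b), par,
    ← Finset.sum_fiberwise _ P]
  simp [par, Finset.filter_filter]

lemma sum_par (p : X → J) (x : X → ZMod 2) : ∑ j, par p x j = ∑ i, x i :=
  Finset.sum_fiberwise Finset.univ p x

lemma dotProduct_snd (p : X → J) (P x : X → ZMod 2) :
    P ⬝ᵥ x = ∑ j, par (fun i => (p i, P i)) x (j, 1) := by
  have := dotProduct_comp (fun i => (p i, P i)) Prod.snd x
  rw [Fintype.sum_prod_type] at this
  simpa [sum_zmod_two, Function.comp_def] using this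

/-- The word that is `v` on the representatives `s` of the columns of `(p, P)` and zero elsewhere. -/
def shift (p : X → J) (P : X → ZMod 2) (s : J × ZMod 2 → X) (v : J → ZMod 2) : X → ZMod 2 :=
  fun i => if i = s (p i, P i) then v (p i) else 0

lemma par_shift {p : X → J} {P : X → ZMod 2} {s : J × ZMod 2 → X}
    (hs : ∀ a, (p (s a), P (s a)) = a) (v : J → ZMod 2) (a : J × ZMod 2) :
    par (fun i => (p i, P i)) (shift p P s v) a = v a.1 := by
  have h1 := congrArg Prod.fst (hs a)
  rw [par, Finset.sum_eq_single (s a)]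
  · simp only [shift, hs a, if_true]; rw [← h1]
  · intro i hi hne
    have hi := (Finset.mem_filter.1 hi).2
    simp [shift, hi, hne]
  · simp [hs a]

/-- Union of translates of the sets `N v` over the vectors `v` with coordinate sum `c`. -/
def glue (p : X → J) (P : X → ZMod 2) (s : J × ZMod 2 → X) (c : ZMod 2)
    (N : {v : J → ZMod 2 // ∑ j, v j = c} → Set (X → ZMod 2)) : Set (X → ZMod 2) :=
  {x | ∃ v, x + shift p P s v ∈ N v}

section Glue

variable {p : X → J} {P : X → ZMod 2} {s : J × ZMod 2 → X} {c : ZMod 2}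
  {N : {v : J → ZMod 2 // ∑ j, v j = c} → Set (X → ZMod 2)}

lemma par_of_mem_glue (hs : ∀ a, (p (s a), P (s a)) = a)
    (hN : ∀ v, ∀ x ∈ N v, par (fun i => (p i, P i)) x = 0) {v} {x : X → ZMod 2}
    (hx : x + shift p P s v ∈ N v) (a : J × ZMod 2) :
    par (fun i => (p i, P i)) x a = v.1 a.1 := by
  have := congrFun (hN v _ hx) a
  rw [par_add, Pi.add_apply, par_shift hs] at this
  exact CharTwo.add_eq_zero.1 this

lemma mem_of_glue_mem (hs : ∀ a, (p (s a), P (s a)) = a)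
    (hN : ∀ v, ∀ x ∈ N v, par (fun i => (p i, P i)) x = 0) {v} {x : X → ZMod 2} :
    x ∈ N v ↔ par (fun i => (p i, P i)) x = 0 ∧ x + shift p P s v ∈ glue p P s c N := by
  have key : x + shift p P s v + shift p P s v = x := by
    rw [add_assoc, word_add_self, add_zero]
  constructor
  · intro hx
    exact ⟨hN v x hx, v, by rwa [key]⟩
  · rintro ⟨hx0, w, hw⟩
    have : w = v := by
      ext j
      have := par_of_mem_glue hs hN hw (j, 0)
      rw [par_add, hx0, zero_add, par_shift hs] at this
      exact this.symm
    rwa [this, key] at hw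

lemma glue_injective (hs : ∀ a, (p (s a), P (s a)) = a)
    {N' : {v : J → ZMod 2 // ∑ j, v j = c} → Set (X → ZMod 2)}
    (hN : ∀ v, ∀ x ∈ N v, par (fun i => (p i, P i)) x = 0)
    (hN' : ∀ v, ∀ x ∈ N' v, par (fun i => (p i, P i)) x = 0)
    (h : glue p P s c N = glue p P s c N') : N = N' := by
  ext v x
  rw [mem_of_glue_mem hs hN, mem_of_glue_mem hs hN', h]

lemma isColComp_glue (hs : ∀ a, (p (s a), P (s a)) = a)
    (hN : ∀ v, IsColComp (fun i => (p i, P i)) (N v)) : IsColComp p (glue p P s c N) where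
  even := by
    rintro x ⟨v, hx⟩
    ext j
    rw [par_fst p P, par_of_mem_glue hs (fun v => (hN v).even) hx,
      par_of_mem_glue hs (fun v => (hN v).even) hx, CharTwo.add_self_eq_zero]
    rfl
  cover := by
    intro y j hy
    set r := par (fun i => (p i, P i)) y with hr
    have hsum : ∀ b, ∑ k, r (k, b) + ∑ k, r (k, b + 1) = 1 := by
      intro b
      have h1 : ∑ k, par p y k = 1 := by simp [hy]
      simp only [par_fst p P, Finset.sum_add_distrib] at h1
      rcases zmod_two_eq_zero_or_one b with rfl | rfl
      · exact h1
      · rw [add_comm]; exact h1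
    obtain ⟨b, hb⟩ : ∃ b, ∑ k, r (k, b) = c := by
      rcases eq_or_eq_add_one (∑ k, r (k, 0)) c with h | h
      · exact ⟨0, h⟩
      · refine ⟨1, ?_⟩
        have h2 := hsum 0
        rw [h, zero_add, add_assoc, add_left_comm, add_eq_left] at h2
        exact (CharTwo.add_eq_zero.1 h2).symm
    have hodd : ∀ k, r (k, b + 1) = r (k, b) + (Pi.single j 1 : J → ZMod 2) k := by
      intro k
      rw [← hy, par_fst p P]
      rcases zmod_two_eq_zero_or_one b with rfl | rfl
      · rw [← add_assoc, CharTwo.add_self_eq_zero, zero_add, zero_add]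
      · rw [← hr, add_left_comm]
        exact (add_eq_left.2 (CharTwo.add_self_eq_zero _)).symm
    let v : {v : J → ZMod 2 // ∑ j, v j = c} := ⟨fun k => r (k, b), hb⟩
    have hpar : par (fun i => (p i, P i)) (y + shift p P s v) = Pi.single (j, b + 1) 1 := by
      ext ⟨k, b'⟩
      rw [par_add, Pi.add_apply, par_shift hs, ← hr]
      change r (k, b') + r (k, b) = _
      rcases eq_or_eq_add_one b' b with rfl | rfl
      · simp [CharTwo.add_self_eq_zero]
      · rw [hodd, add_right_comm, CharTwo.add_self_eq_zero, zero_add]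
        simp [Pi.single_apply]
    obtain ⟨i, hi, huniq⟩ := (hN v).cover _ _ hpar
    refine ⟨i, ⟨v, by rwa [add_right_comm]⟩, ?_⟩
    rintro i' ⟨v', hi'⟩
    have hv' : ∀ a : J × ZMod 2,
        r a + (Pi.single (p i', P i') 1 : J × ZMod 2 → ZMod 2) a = v'.1 a.1 := by
      intro a
      rw [← par_of_mem_glue hs (fun v => (hN v).even) hi' a, par_add, par_single]; rfl
    have hv2 : v'.1 = fun k => r (k, P i' + 1) := by
      ext k
      rw [← hv' (k, P i' + 1)]
      simp
    rcases eq_or_eq_add_one b (P i') with h | h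
    · exfalso
      have h2 := hsum b
      rw [hb] at h2
      have h3 := v'.2
      rw [hv2] at h3; simp only [← h] at h3
      rw [h3, CharTwo.add_self_eq_zero] at h2
      exact zero_ne_one h2
    · have : v' = v := Subtype.ext (by rw [hv2]; simp only [← h]; rfl)
      subst this
      exact huniq i' (by simpa only [add_right_comm] using hi')

lemma value_glue (hs : ∀ a, (p (s a), P (s a)) = a)
    (hN : ∀ v, ∀ x ∈ N v, par (fun i => (p i, P i)) x = 0) :
    ∀ x ∈ glue p P s c N, P ⬝ᵥ x = c := by
  rintro x ⟨v, hx⟩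
  rw [dotProduct_snd p, ← v.2]
  exact Finset.sum_congr rfl fun j _ => par_of_mem_glue hs hN hx (j, 1)

lemma ann_glue_of_factors [Nonempty J] (hs : ∀ a, (p (s a), P (s a)) = a)
    (hN : ∀ v, ∀ x ∈ N v, par (fun i => (p i, P i)) x = 0) (hne : ∀ v, (N v).Nonempty)
    {Q : X → ZMod 2} {q : ZMod 2} (hQ : ∀ x ∈ glue p P s c N, Q ⬝ᵥ x = q)
    {f : J × ZMod 2 → ZMod 2} (hf : ∀ i, Q i = f (p i, P i)) :
    ∃ g : J → ZMod 2, ∃ e, ∀ i, Q i = g (p i) + e * P i := by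
  have hq : ∀ v : J → ZMod 2, ∑ j, v j = c → ∑ j, (f (j, 0) + f (j, 1)) * v j = q := by
    intro v hv
    obtain ⟨y, hy⟩ := hne ⟨v, hv⟩
    have hx := ((mem_of_glue_mem hs hN).1 hy).2
    rw [← hQ _ hx]
    have : Q = f ∘ fun i => (p i, P i) := funext hf
    rw [this, dotProduct_comp, Fintype.sum_prod_type]
    refine Finset.sum_congr rfl fun j _ => ?_
    rw [par_add, hN _ y hy, zero_add, sum_zmod_two, par_shift hs, par_shift hs, add_mul]
  obtain ⟨j₀⟩ := ‹Nonempty J›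
  refine ⟨fun j => f (j, 0), f (j₀, 0) + f (j₀, 1), fun i => ?_⟩
  have h1 := hq (Pi.single j₀ c) (by simp)
  have h2 := hq (Pi.single j₀ c + (Pi.single j₀ 1 + Pi.single (p i) 1))
    (by simp [Finset.sum_add_distrib, CharTwo.add_self_eq_zero])
  simp only [Pi.add_apply, mul_add, Finset.sum_add_distrib (s := Finset.univ)] at h1 h2
  simp only [Pi.single_apply, mul_ite, mul_zero, mul_one, Finset.sum_ite_eq',
    Finset.mem_univ, if_true] at h1 h2
  rw [hf]
  generalize P i = b at *
  generalize p i = j at *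
  rcases zmod_two_eq_zero_or_one b with rfl | rfl
  · simp
  · rw [h1, add_eq_left] at h2
    have h3 : f (j₀, 0) + f (j₀, 1) = f (j, 0) + f (j, 1) := CharTwo.add_eq_zero.1 h2
    simp only [mul_one]
    rw [h3, ← add_assoc, CharTwo.add_self_eq_zero, zero_add]

end Glue

section Tight

variable {p : X → J} {P : X → ZMod 2} {s : J × ZMod 2 → X} {c : ZMod 2}

lemma IsColComp.nonempty [Nonempty X] {N : Set (X → ZMod 2)} (h : IsColComp p N) : N.Nonempty := by
  obtain ⟨i⟩ := ‹Nonempty X›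
  obtain ⟨i', hi', -⟩ := h.cover _ _ (par_single p i)
  exact ⟨_, hi'⟩

lemma dotProduct_shift (hs : ∀ a, (p (s a), P (s a)) = a) (Q : X → ZMod 2) (v : J → ZMod 2) :
    Q ⬝ᵥ shift p P s v = ∑ j, v j * (Q (s (j, 0)) + Q (s (j, 1))) := by
  have h : Q ⬝ᵥ shift p P s v = ((Q ∘ s) ∘ fun i => (p i, P i)) ⬝ᵥ shift p P s v := by
    refine Finset.sum_congr rfl fun i _ => ?_
    by_cases hi : i = s (p i, P i)
    · simp only [Function.comp_apply, ← hi]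
    · simp [shift, hi]
  rw [h, dotProduct_comp, Fintype.sum_prod_type]
  refine Finset.sum_congr rfl fun j _ => ?_
  rw [sum_zmod_two, par_shift hs, par_shift hs, mul_add, mul_comm, mul_comm (v j) (Q _)]
  simp [mul_comm]

lemma isTight_glue [Nonempty J] (hs : ∀ a, (p (s a), P (s a)) = a)
    {N : {v : J → ZMod 2 // ∑ j, v j = c} → Set (X → ZMod 2)}
    {P' : {v : J → ZMod 2 // ∑ j, v j = c} → X → ZMod 2}
    {c' : {v : J → ZMod 2 // ∑ j, v j = c} → ZMod 2}
    (hN : ∀ v, IsTight (fun i => (p i, P i)) (P' v) (c' v) (N v))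
    (hP' : ∀ v a, P' v (s a) = 0)
    (hex : ¬ ∃ P₀ q, ∃ g : J → ZMod 2, ∀ v, P' v = P₀ ∧ c' v = q + ∑ j, v.1 j * g j) :
    IsTight p P c (glue p P s c N) where
  comp := isColComp_glue hs fun v => (hN v).comp
  value := value_glue hs fun v => (hN v).comp.even
  ann := by
    intro Q q hQ
    have : Nonempty X := Nonempty.map (fun j => s (j, 0)) ‹_›
    by_cases hfac : ∃ f : J × ZMod 2 → ZMod 2, ∀ i, Q i = f (p i, P i)
    · obtain ⟨f, hf⟩ := hfac
      exact ann_glue_of_factors hs (fun v => (hN v).comp.even) (fun v => (hN v).comp.nonempty) hQ hf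
    refine absurd ⟨Q + (Q ∘ s) ∘ fun i => (p i, P i), q,
      fun j => Q (s (j, 0)) + Q (s (j, 1)), fun v => ?_⟩ hex
    have hdot : ∀ y ∈ N v, Q ⬝ᵥ y = q + Q ⬝ᵥ shift p P s v.1 := by
      intro y hy
      have := hQ _ ((mem_of_glue_mem hs fun v => (hN v).comp.even).1 hy).2
      rw [← this, dotProduct_add, add_assoc, CharTwo.add_self_eq_zero, add_zero]
    obtain ⟨f, e, hfe⟩ := (hN v).ann Q _ hdot
    rcases zmod_two_eq_zero_or_one e with rfl | rfl
    · exact absurd ⟨f, fun i => by simpa using hfe i⟩ hfac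
    have hf : ∀ a, f a = Q (s a) := by
      intro a
      have := hfe (s a)
      rw [hs, hP', mul_zero, add_zero] at this
      exact this.symm
    have hP₀ : P' v = Q + (Q ∘ s) ∘ fun i => (p i, P i) := by
      ext i
      have := hfe i
      rw [hf, one_mul] at this
      simp only [Pi.add_apply, Function.comp_apply]
      rw [this, add_right_comm, CharTwo.add_self_eq_zero, zero_add]
    refine ⟨hP₀, ?_⟩
    obtain ⟨y, hy⟩ := (hN v).comp.nonempty
    rw [← (hN v).value y hy, hP₀, add_dotProduct, hdot y hy, dotProduct_comp,
      (hN v).comp.even y hy, dotProduct_shift hs]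
    simp

lemma exists_isTight_of_uniform_one [Nonempty J] (h : Uniform (fun i => (p i, P i)) 1)
    (c : ZMod 2) : ∃ N, IsTight p P c N := by
  have hs : ∀ a, ∃ i, Finset.univ.filter (fun i => (p i, P i) = a) = {i} :=
    fun a => Finset.card_eq_one.1 (h a)
  choose s hs using hs
  have hs1 : ∀ a, (p (s a), P (s a)) = a := fun a => by
    have : s a ∈ Finset.univ.filter (fun i => (p i, P i) = a) := by rw [hs]; simp
    exact (Finset.mem_filter.1 this).2
  have hs2 : ∀ i, s (p i, P i) = i := fun i => by
    have : i ∈ Finset.univ.filter (fun i' => (p i', P i') = (p i, P i)) := by simp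
    rw [hs] at this
    exact (Finset.mem_singleton.1 this).symm
  have hpar : ∀ x : X → ZMod 2, par (fun i => (p i, P i)) x = x ∘ s := fun x => by
    ext a; simp [par, hs]
  let N : {v : J → ZMod 2 // ∑ j, v j = c} → Set (X → ZMod 2) := fun _ => {0}
  have hN : ∀ v, IsColComp (fun i => (p i, P i)) (N v) := by
    refine fun v => ⟨?_, ?_⟩
    · rintro x rfl
      rw [hpar]; rfl
    · intro y a hy
      have hy' : y = Pi.single (s a) 1 := by
        ext i
        have := congrFun hy (p i, P i)
        rw [hpar, Function.comp_apply, hs2] at this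
        rw [this]
        simp only [Pi.single_apply]
        congr 1
        exact propext ⟨fun h => by rw [← h, hs2], fun h => by rw [h, hs1]⟩
      refine ⟨s a, ?_, ?_⟩
      · change y + Pi.single (s a) 1 = 0
        rw [hy', word_add_self]
      intro i hi
      have h1 : (Pi.single (s a) 1 : X → ZMod 2) = Pi.single i 1 := by
        rw [← hy']
        ext k
        exact CharTwo.add_eq_zero.1 (congrFun hi k)
      by_contra hne
      have := congrFun h1 i
      simp [hne] at this
  refine ⟨glue p P s c N, isColComp_glue hs1 hN, value_glue hs1 fun v => (hN v).even, ?_⟩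
  intro Q q hQ
  exact ann_glue_of_factors hs1 (fun v => (hN v).even) (fun v => ⟨0, rfl⟩) hQ (f := Q ∘ s)
    fun i => by rw [Function.comp_apply, hs2]

lemma IsTight.unique [Nonempty X] {r : J → X} {P' : X → ZMod 2} {c' : ZMod 2}
    {N : Set (X → ZMod 2)} (hr : ∀ j, p (r j) = j)
    (h : IsTight p P c N) (h' : IsTight p P' c' N) (hP : ∀ j, P (r j) = 0)
    (hP' : ∀ j, P' (r j) = 0) (hne : ∃ i, P' i ≠ 0) : P = P' ∧ c = c' := by
  have hPP : P = P' := by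
    obtain ⟨f, e, hfe⟩ := h.ann P' c' h'.value
    have hf : ∀ j, f j = 0 := by
      intro j
      have := hfe (r j)
      rw [hP, hP', hr, mul_zero, add_zero] at this
      exact this.symm
    simp only [hf, zero_add] at hfe
    rcases zmod_two_eq_zero_or_one e with rfl | rfl
    · obtain ⟨i, hi⟩ := hne
      exact absurd (by simpa using hfe i) hi
    · ext i; simp [hfe i]
  obtain ⟨x, hx⟩ := h.comp.nonempty
  exact ⟨hPP, by rw [← h.value x hx, ← h'.value x hx, hPP]⟩

end Tight

section Halves

/-- Choices of a `k`-subset avoiding the base point `s j` in every fibre of `p`. -/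
def halves (p : X → J) (s : J → X) (k : ℕ) : Finset (J → Finset X) :=
  Fintype.piFinset fun j => ((Finset.univ.filter fun i => p i = j).erase (s j)).powersetCard k

/-- The indicator of the union of the chosen subsets. -/
def halfInd (p : X → J) (A : J → Finset X) (i : X) : ZMod 2 := if i ∈ A (p i) then 1 else 0

variable {p : X → J} {s : J → X} {k : ℕ}

lemma choose_double_half (hk : 0 < k) : (2 * k).choose k / 2 = (2 * k - 1).choose k := by
  obtain ⟨l, rfl⟩ := Nat.exists_eq_succ_of_ne_zero hk.ne'
  rw [Nat.succ_eq_add_one, show 2 * (l + 1) = (2 * l + 1) + 1 by ring, Nat.choose_succ_succ,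
    Nat.succ_eq_add_one, Nat.add_sub_cancel, Nat.choose_symm_half]
  omega

lemma card_halves (hk : 0 < k) (hp : Uniform p (2 * k)) (hs : ∀ j, p (s j) = j) :
    (halves p s k).card = ((2 * k).choose k / 2) ^ Fintype.card J := by
  rw [halves, Fintype.card_piFinset, Finset.prod_congr rfl (g := fun _ => (2 * k).choose k / 2)]
  · simp
  · intro j _
    rw [Finset.card_powersetCard, Finset.card_erase_of_mem (by simp [hs]), hp j,
      choose_double_half hk]

lemma mem_halves {A : J → Finset X} (hA : A ∈ halves p s k) (j : J) :
    (∀ i ∈ A j, i ≠ s j ∧ p i = j) ∧ (A j).card = k := by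
  have := Finset.mem_powersetCard.1 (Fintype.mem_piFinset.1 hA j)
  exact ⟨fun i hi => by simpa using this.1 hi, this.2⟩

lemma halfInd_base {A : J → Finset X} (hA : A ∈ halves p s k) (hs : ∀ j, p (s j) = j) (j : J) :
    halfInd p A (s j) = 0 := by
  rw [halfInd, if_neg]
  rw [hs]
  exact fun h => ((mem_halves hA j).1 _ h).1 rfl

lemma filter_halfInd_one {A : J → Finset X} (hA : A ∈ halves p s k) (j : J) :
    Finset.univ.filter (fun i => (p i, halfInd p A i) = (j, 1)) = A j := by
  ext i
  simp only [halfInd, Finset.mem_filter, Finset.mem_univ, true_and, Prod.mk.injEq]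
  constructor
  · rintro ⟨rfl, h⟩
    by_contra hi
    simp [hi] at h
  · intro hi
    have := ((mem_halves hA j).1 i hi).2
    simp [this, hi]

lemma halfInd_injOn {A B : J → Finset X} (hA : A ∈ halves p s k) (hB : B ∈ halves p s k)
    (h : halfInd p A = halfInd p B) : A = B := by
  ext1 j
  rw [← filter_halfInd_one hA, ← filter_halfInd_one hB, h]

lemma uniform_halfInd {A : J → Finset X} (hA : A ∈ halves p s k) (hp : Uniform p (2 * k)) :
    Uniform (fun i => (p i, halfInd p A i)) k := by
  rintro ⟨j, b⟩
  have h1 := filter_halfInd_one hA j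
  rcases zmod_two_eq_zero_or_one b with rfl | rfl
  · have h0 : Finset.univ.filter (fun i => (p i, halfInd p A i) = (j, 0)) =
        Finset.univ.filter (fun i => p i = j) \ A j := by
      rw [← h1]
      ext i
      simp only [Finset.mem_filter, Finset.mem_univ, true_and, Prod.mk.injEq, Finset.mem_sdiff,
        not_and]
      rcases zmod_two_eq_zero_or_one (halfInd p A i) with h | h <;> simp [h]
    rw [h0, Finset.card_sdiff_of_subset, hp j, (mem_halves hA j).2]
    · omega
    · intro i hi
      simpa using ((mem_halves hA j).1 i hi).2
  · rw [h1, (mem_halves hA j).2]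

end Halves

section Counting

lemma card_linear_fiber (u : J → ZMod 2) {j₀ : J} (hu : u j₀ = 1) (c : ZMod 2) :
    Fintype.card {v : J → ZMod 2 // ∑ j, u j * v j = c} = 2 ^ (Fintype.card J - 1) := by
  have hadd : ∀ v : J → ZMod 2, ∑ j, u j * (v + Pi.single j₀ 1 : J → ZMod 2) j = ∑ j, u j * v j + 1 := by
    intro v
    simp [mul_add, Finset.sum_add_distrib, Pi.single_apply, hu]
  have heq : ∀ d, Fintype.card {v : J → ZMod 2 // ∑ j, u j * v j = d} ≤
      Fintype.card {v : J → ZMod 2 // ∑ j, u j * v j = d + 1} := by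
    intro d
    refine Fintype.card_le_of_injective
      (fun v => ⟨v.1 + Pi.single j₀ 1, by rw [hadd, v.2]⟩) fun v w h => ?_
    simpa [Subtype.ext_iff] using h
  have h01 := heq 0
  have h10 := heq 1
  have htot : Fintype.card {v : J → ZMod 2 // ∑ j, u j * v j = 0} +
      Fintype.card {v : J → ZMod 2 // ∑ j, u j * v j = 1} = 2 ^ Fintype.card J := by
    have h := Finset.card_eq_sum_card_fiberwise (s := (Finset.univ : Finset (J → ZMod 2)))
      (t := Finset.univ) (f := fun v => ∑ j, u j * v j) (by simp)
    rw [sum_zmod_two] at h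
    simp only [Fintype.card_subtype]
    rw [← h]
    simp [ZMod.card]
  rw [zero_add] at h01
  rw [show (1 : ZMod 2) + 1 = 0 from rfl] at h10
  have hpos : 0 < Fintype.card J := Fintype.card_pos_iff.2 ⟨j₀⟩
  have hpow : 2 ^ Fintype.card J = 2 * 2 ^ (Fintype.card J - 1) := by
    rw [← pow_succ', Nat.sub_add_cancel hpos]
  rcases zmod_two_eq_zero_or_one c with rfl | rfl <;> omega

lemma card_sum_eq [Nonempty J] (c : ZMod 2) :
    Fintype.card {v : J → ZMod 2 // ∑ j, v j = c} = 2 ^ (Fintype.card J - 1) := by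
  have := card_linear_fiber (fun _ : J => 1) (j₀ := Classical.arbitrary J) rfl c
  simpa only [one_mul] using this

lemma card_apply_eq_zero (j₀ : J) :
    Fintype.card {v : J → ZMod 2 // v j₀ = 0} = 2 ^ (Fintype.card J - 1) := by
  have := card_linear_fiber (Pi.single j₀ 1) (j₀ := j₀) (by simp) 0
  simpa [Pi.single_apply] using this

lemma card_exceptional_le [Nonempty J] {D : Type} [Fintype D] (c : ZMod 2) :
    Nat.card {δ : {v : J → ZMod 2 // ∑ j, v j = c} → D × ZMod 2 //
      ∃ d q, ∃ g : J → ZMod 2, ∀ v, δ v = (d, q + ∑ j, v.1 j * g j)} ≤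
      2 * Fintype.card D * 2 ^ (Fintype.card J - 1) := by
  let j₀ := Classical.arbitrary J
  let F : (D × ZMod 2) × {g : J → ZMod 2 // g j₀ = 0} →
      {δ : {v : J → ZMod 2 // ∑ j, v j = c} → D × ZMod 2 //
        ∃ d q, ∃ g : J → ZMod 2, ∀ v, δ v = (d, q + ∑ j, v.1 j * g j)} :=
    fun a => ⟨fun v => (a.1.1, a.1.2 + ∑ j, v.1 j * a.2.1 j), a.1.1, a.1.2, a.2.1, fun _ => rfl⟩
  have hF : Function.Surjective F := by
    rintro ⟨δ, d, q, g, h⟩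
    refine ⟨((d, q + c * g j₀), ⟨fun j => g j + g j₀, CharTwo.add_self_eq_zero _⟩), ?_⟩
    refine Subtype.ext (funext fun v => ?_)
    change _ = δ v
    rw [h]
    simp only [F, mul_add, Finset.sum_add_distrib, ← Finset.sum_mul, v.2, Prod.mk.injEq, true_and]
    rw [add_comm (∑ j, _), ← add_assoc, add_assoc q, CharTwo.add_self_eq_zero, add_zero]
  refine (Nat.card_le_card_of_surjective F hF).trans (le_of_eq ?_)
  rw [Nat.card_eq_fintype_card, Fintype.card_prod, Fintype.card_prod, card_apply_eq_zero, ZMod.card,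
    mul_comm 2]

lemma card_families_le {V D T T' : Type} [Fintype V] [DecidableEq V] [Fintype D] [Finite T']
    {S : D → Set T} {R : Set T'} {E : (V → D) → Prop} {G : (V → T) → T'} {e F : ℕ}
    (hE : Nat.card {δ // E δ} ≤ e) (hF : ∀ d, F ≤ Nat.card (S d))
    (hdisj : ∀ d d' x, x ∈ S d → x ∈ S d' → d = d')
    (hR : ∀ δ, ¬ E δ → ∀ N : V → T, (∀ v, N v ∈ S (δ v)) → G N ∈ R)
    (hinj : ∀ δ δ' : V → D, ∀ N N' : V → T, (∀ v, N v ∈ S (δ v)) → (∀ v, N' v ∈ S (δ' v)) →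
      G N = G N' → N = N') :
    F ^ Fintype.card V * (Fintype.card D ^ Fintype.card V - e) ≤ Nat.card R := by
  classical
  have hemb : ∀ d, ∃ φ : Fin F → S d, Function.Injective φ := by
    intro d
    rcases Nat.eq_zero_or_pos F with rfl | hpos
    · exact ⟨Fin.elim0, fun i => i.elim0⟩
    have : Finite (S d) := Nat.finite_of_card_ne_zero (by have := hF d; omega)
    have := Fintype.ofFinite (S d)
    have hle : Fintype.card (Fin F) ≤ Fintype.card (S d) := by
      rw [Fintype.card_fin, ← Nat.card_eq_fintype_card]; exact hF d
    obtain ⟨φ⟩ := Function.Embedding.nonempty_of_card_le hle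
    exact ⟨φ, φ.injective⟩
  choose φ hφ using hemb
  let Ψ : {δ : V → D // ¬ E δ} × (V → Fin F) → R := fun a =>
    ⟨G fun v => (φ (a.1.1 v) (a.2 v) : T), hR _ a.1.2 _ fun v => (φ _ _).2⟩
  have hΨ : Function.Injective Ψ := by
    rintro ⟨⟨δ, hδ⟩, κ⟩ ⟨⟨δ', hδ'⟩, κ'⟩ h
    have h1 := hinj δ δ' _ _ (fun v => (φ _ _).2) (fun v => (φ _ _).2) (congrArg Subtype.val h)
    have hd : δ = δ' := by
      ext1 v
      refine hdisj _ _ _ (φ (δ v) (κ v)).2 ?_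
      rw [congrFun h1 v]
      exact (φ _ _).2
    subst hd
    have hk : κ = κ' := by
      ext1 v
      exact hφ _ (Subtype.ext (congrFun h1 v))
    rw [hk]
  have := Nat.card_le_card_of_injective Ψ hΨ
  refine le_trans ?_ this
  rw [Nat.card_eq_fintype_card, Fintype.card_prod, Fintype.card_subtype_compl, Fintype.card_fun,
    Fintype.card_fun, Fintype.card_fin, mul_comm]
  rw [Nat.card_eq_fintype_card] at hE
  gcongr

end Counting

section Recursion

/-- The lower bound for the number of tight components with `2 ^ (t + 1)` rows. -/
def familyBound (m t : ℕ) : ℕ :=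
  ∏ τ ∈ Finset.Icc 1 t, ((Dfac m τ) ^ (Wfac m (τ + 1)) - (Dfac m τ) * (Wfac m (τ + 1))) ^
    (∏ i ∈ Finset.Icc (τ + 2) (t + 1), Wfac m i)

lemma familyBound_succ (m t : ℕ) :
    familyBound m (t + 1) = familyBound m t ^ Wfac m (t + 2) *
      ((Dfac m (t + 1)) ^ (Wfac m (t + 2)) - (Dfac m (t + 1)) * (Wfac m (t + 2))) := by
  rw [familyBound, Finset.prod_Icc_succ_top (by omega), familyBound, ← Finset.prod_pow]
  congr 1
  · refine Finset.prod_congr rfl fun τ hτ => ?_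
    rw [Finset.mem_Icc] at hτ
    rw [Finset.prod_Icc_succ_top (by omega), pow_mul]
  · rw [Finset.Icc_eq_empty (by omega), Finset.prod_empty, pow_one]

lemma Uniform.exists_section {q : X → J} {k : ℕ} (h : Uniform q k) (hk : 0 < k) :
    ∃ s : J → X, ∀ a, q (s a) = a := by
  have : ∀ a, ∃ i, q i = a := by
    intro a
    obtain ⟨i, hi⟩ := Finset.card_pos.1 ((h a).symm ▸ hk)
    exact ⟨i, by simpa using hi⟩
  choose s hs using this
  exact ⟨s, hs⟩

theorem familyBound_le_card (m t : ℕ) (ht : t + 1 ≤ m) {J : Type} [Fintype J]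
    [DecidableEq J] (hJ : Fintype.card J = 2 ^ (m - t - 1)) {p : X → J} {P : X → ZMod 2}
    (hP : Uniform (fun i => (p i, P i)) (2 ^ t)) (c : ZMod 2) :
    familyBound m t ≤ Nat.card {N | IsTight p P c N} := by
  induction t generalizing J p P c with
  | zero =>
    have : Nonempty J := Fintype.card_pos_iff.1 (by rw [hJ]; positivity)
    obtain ⟨N, hN⟩ := exists_isTight_of_uniform_one hP c
    have : Nonempty {N | IsTight p P c N} := ⟨⟨N, hN⟩⟩
    have h1 : familyBound m 0 = 1 := by simp [familyBound]
    rw [h1]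
    exact Nat.card_pos
  | succ t ih =>
    have : Nonempty J := Fintype.card_pos_iff.1 (by rw [hJ]; positivity)
    obtain ⟨s, hs⟩ := hP.exists_section (by positivity)
    have : Nonempty X := Nonempty.map (fun j => s (j, 0)) ‹_›
    have hk : 0 < 2 ^ t := by positivity
    have hP2 : Uniform (fun i => (p i, P i)) (2 * 2 ^ t) := by rwa [← pow_succ']
    have hJ2 : Fintype.card (J × ZMod 2) = 2 ^ (m - t - 1) := by
      rw [Fintype.card_prod, hJ, ZMod.card, ← pow_succ]
      congr 1; omega
    have hD := card_halves hk hP2 hs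
    have hDcard : Fintype.card ({A // A ∈ halves (fun i => (p i, P i)) s (2 ^ t)} × ZMod 2) =
        Dfac m (t + 1) := by
      rw [Fintype.card_prod, ZMod.card, Fintype.card_coe, hD, hJ2, Dfac, mul_comm, pow_succ',
        Nat.add_sub_cancel, Nat.sub_sub]
    have hVcard : Fintype.card {v : J → ZMod 2 // ∑ j, v j = c} = Wfac m (t + 2) := by
      rw [card_sum_eq, hJ, Wfac, Nat.sub_sub]
    have hE := card_exceptional_le (J := J)
      (D := {A // A ∈ halves (fun i => (p i, P i)) s (2 ^ t)}) c
    have hDW : 2 * Fintype.card {A // A ∈ halves (fun i => (p i, P i)) s (2 ^ t)} *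
        2 ^ (Fintype.card J - 1) = Dfac m (t + 1) * Wfac m (t + 2) := by
      rw [← hDcard, ← hVcard, card_sum_eq, Fintype.card_prod, ZMod.card, mul_comm 2]
    rw [hDW] at hE
    have hinh : ∀ A ∈ halves (fun i => (p i, P i)) s (2 ^ t),
        ∃ i, halfInd (fun i => (p i, P i)) A i ≠ 0 := by
      intro A hA
      obtain ⟨r, hr⟩ := (uniform_halfInd hA hP2).exists_section hk
      refine ⟨r (Classical.arbitrary _, 1), ?_⟩
      exact (congrArg Prod.snd (hr (Classical.arbitrary _, 1))).trans_ne one_ne_zero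
    have key := card_families_le (V := {v : J → ZMod 2 // ∑ j, v j = c})
      (S := fun d : {A // A ∈ halves (fun i => (p i, P i)) s (2 ^ t)} × ZMod 2 =>
        {N | IsTight (fun i => (p i, P i)) (halfInd (fun i => (p i, P i)) d.1.1) d.2 N})
      (R := {N | IsTight p P c N}) (G := glue p P s c) hE
      (fun d => ih (by omega) hJ2 (uniform_halfInd d.1.2 hP2) d.2) ?_ ?_ ?_
    · rwa [hDcard, hVcard, ← familyBound_succ] at key
    · rintro ⟨⟨A, hA⟩, a⟩ ⟨⟨B, hB⟩, b⟩ N hN hN'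
      obtain ⟨h1, h2⟩ := IsTight.unique hs hN hN' (halfInd_base hA hs) (halfInd_base hB hs)
        (hinh B hB)
      exact Prod.ext (Subtype.ext (halfInd_injOn hA hB h1)) h2
    · intro δ hδ N hN
      refine isTight_glue hs hN (fun v => halfInd_base (δ v).1.2 hs) ?_
      rintro ⟨P₀, q, g, h⟩
      obtain ⟨v₀⟩ : Nonempty {v : J → ZMod 2 // ∑ j, v j = c} :=
        ⟨⟨Pi.single (Classical.arbitrary J) c, by simp⟩⟩
      refine hδ ⟨(δ v₀).1, q, g, fun v => Prod.ext (Subtype.ext ?_) (h v).2⟩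
      exact halfInd_injOn (δ v).1.2 (δ v₀).1.2 ((h v).1.trans (h v₀).1.symm)
    · intro δ δ' N N' hN hN' h
      exact glue_injective hs (fun v => (hN v).comp.even) (fun v => (hN' v).comp.even) h

end Recursion

section Quarters

/-- Extended perfect codes: even words such that each odd word has a unique neighbour in `M`. -/
def IsExtPerfect (M : Set (X → ZMod 2)) : Prop :=
  (∀ x ∈ M, ∑ i, x i = 0) ∧ ∀ y : X → ZMod 2, ∑ i, y i = 1 → ∃! i, y + Pi.single i 1 ∈ M

lemma IsColComp.isExtPerfect {p : X → ZMod 2} {M : Set (X → ZMod 2)} (h : IsColComp p M) :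
    IsExtPerfect M := by
  refine ⟨fun x hx => by rw [← sum_par p, h.even x hx]; simp, fun y hy => ?_⟩
  rw [← sum_par p, sum_zmod_two] at hy
  have hj : ∃ j, par p y = Pi.single j 1 := by
    rcases zmod_two_eq_zero_or_one (par p y 0) with h0 | h0
    · rw [h0, zero_add] at hy
      refine ⟨1, funext fun j => ?_⟩
      rcases zmod_two_eq_zero_or_one j with rfl | rfl
      · rw [h0]; rfl
      · rw [hy]; rfl
    · rw [h0, add_eq_left] at hy
      refine ⟨0, funext fun j => ?_⟩
      rcases zmod_two_eq_zero_or_one j with rfl | rfl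
      · rw [h0]; rfl
      · rw [hy]; rfl
  obtain ⟨j, hj⟩ := hj
  exact h.cover y j hj

lemma IsExtPerfect.translate {M : Set (X → ZMod 2)} (h : IsExtPerfect M) {w : X → ZMod 2}
    (hw : ∑ i, w i = 0) : IsExtPerfect {x | x + w ∈ M} := by
  refine ⟨fun x hx => ?_, fun y hy => ?_⟩
  · have := h.1 _ hx
    simpa [Finset.sum_add_distrib, hw] using this
  · have := h.2 (y + w) (by simp [Finset.sum_add_distrib, hw, hy])
    simpa only [Set.mem_ofPred_eq, add_right_comm] using this

lemma multinomial_le_card_uniform {Y : Type} [Fintype Y] [DecidableEq Y] {q : X → Y} {k : ℕ}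
    (hq : Uniform q k) :
    (Fintype.card X).factorial ≤
      Nat.card {f : X → Y // Uniform f k} * k.factorial ^ Fintype.card Y := by
  classical
  let Φ : Equiv.Perm X → {f : X → Y // Uniform f k} := fun σ => ⟨q ∘ σ, fun j => by
    rw [← hq j]
    exact Finset.card_equiv σ fun i => by simp⟩
  have hfib : ∀ f : {f : X → Y // Uniform f k},
      (Finset.univ.filter fun σ => Φ σ = f).card ≤ k.factorial ^ Fintype.card Y := by
    intro f
    rcases (Finset.univ.filter fun σ => Φ σ = f).eq_empty_or_nonempty with h | ⟨σ₀, hσ₀⟩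
    · rw [h]; simp
    have hstab := DomMulAct.stabilizer_card q
    have hfac : ∀ j, (Fintype.card {a // q a = j}).factorial = k.factorial := by
      intro j; rw [Fintype.card_subtype, hq j]
    simp only [hfac, Finset.prod_const, Finset.card_univ] at hstab
    rw [← hstab, ← Fintype.card_coe]
    refine Fintype.card_le_of_injective
      (fun σ => ⟨σ.1 * σ₀⁻¹, ?_⟩) fun σ τ h => ?_
    · have h1 := (Finset.mem_filter.1 σ.2).2
      have h2 := (Finset.mem_filter.1 hσ₀).2
      have h3 : q ∘ σ.1 = q ∘ σ₀ := congrArg Subtype.val (h1.trans h2.symm)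
      ext a
      exact (congrFun h3 (σ₀⁻¹ a)).trans (congrArg q (Equiv.apply_symm_apply σ₀ a))
    · exact Subtype.ext (mul_right_cancel (congrArg Subtype.val h))
  have h := Finset.card_le_mul_card_image (s := (Finset.univ : Finset (Equiv.Perm X)))
    (f := Φ) (k.factorial ^ Fintype.card Y) (fun f _ => by simpa using hfib f)
  rw [Finset.card_univ, Fintype.card_perm] at h
  refine h.trans ?_
  rw [mul_comm, Nat.card_eq_fintype_card]
  gcongr
  exact Finset.card_le_univ _

/-- The affine constraints of an extended perfect code split into quarters by `f`. -/
structure IsQuartered (f : X → ZMod 2 × ZMod 2) (d : ZMod 2 × ZMod 2)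
    (M : Set (X → ZMod 2)) : Prop where
  perfect : IsExtPerfect M
  value_fst : ∀ x ∈ M, (fun i => (f i).1) ⬝ᵥ x = d.1
  value_snd : ∀ x ∈ M, (fun i => (f i).2) ⬝ᵥ x = d.2
  ann : ∀ Q q, (∀ x ∈ M, Q ⬝ᵥ x = q) → ∃ g : ZMod 2 × ZMod 2 → ZMod 2, Q = g ∘ f

lemma IsTight.isQuartered {p P : X → ZMod 2} {M : Set (X → ZMod 2)} (h : IsTight p P 0 M)
    {w : X → ZMod 2} (hw : ∑ i, w i = 0) :
    IsQuartered (fun i => (p i, P i)) (p ⬝ᵥ w, P ⬝ᵥ w) {x | x + w ∈ M} where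
  perfect := h.comp.isExtPerfect.translate hw
  value_fst := by
    intro x hx
    have h1 : p ⬝ᵥ (x + w) = 0 := by
      have := dotProduct_comp p id (x + w)
      rw [h.comp.even _ hx] at this
      simpa using this
    rw [dotProduct_add] at h1
    exact CharTwo.add_eq_zero.1 h1
  value_snd := by
    intro x hx
    have h1 := h.value _ hx
    rw [dotProduct_add] at h1
    exact CharTwo.add_eq_zero.1 h1
  ann := by
    intro Q q hQ
    obtain ⟨f, e, hfe⟩ := h.ann Q (q + Q ⬝ᵥ w) fun x hx => by
      have := hQ (x + w) (by
        change x + w + w ∈ M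
        rwa [add_assoc, word_add_self, add_zero])
      rw [← this, dotProduct_add, add_assoc, CharTwo.add_self_eq_zero, add_zero]
    exact ⟨fun a => f a.1 + e * a.2, funext hfe⟩

lemma IsExtPerfect.nonempty [Nonempty X] {M : Set (X → ZMod 2)} (h : IsExtPerfect M) :
    M.Nonempty := by
  obtain ⟨i⟩ := ‹Nonempty X›
  obtain ⟨i', hi', -⟩ := h.2 (Pi.single i 1) (by simp)
  exact ⟨_, hi'⟩

lemma IsQuartered.exists_perm {f f' : X → ZMod 2 × ZMod 2} {d d' : ZMod 2 × ZMod 2}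
    {M : Set (X → ZMod 2)} (h : IsQuartered f d M) (h' : IsQuartered f' d' M)
    (hf' : Function.Surjective f') : ∃ σ : Equiv.Perm (ZMod 2 × ZMod 2), f' = σ ∘ f := by
  obtain ⟨g, hg⟩ := h.ann _ _ h'.value_fst
  obtain ⟨g', hg'⟩ := h.ann _ _ h'.value_snd
  have hcomp : f' = (fun a => (g a, g' a)) ∘ f := by
    ext1 i
    exact Prod.ext (congrFun hg i) (congrFun hg' i)
  have hsurj : Function.Surjective fun a => (g a, g' a) :=
    Function.Surjective.of_comp (hcomp ▸ hf')
  exact ⟨Equiv.ofBijective _ (Finite.injective_iff_bijective.1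
    (Finite.injective_iff_surjective.2 hsurj)), hcomp⟩

lemma IsQuartered.value_unique [Nonempty X] {f : X → ZMod 2 × ZMod 2} {d d' : ZMod 2 × ZMod 2}
    {M : Set (X → ZMod 2)} (h : IsQuartered f d M) (h' : IsQuartered f d' M) : d = d' := by
  obtain ⟨x, hx⟩ := h.perfect.nonempty
  exact Prod.ext (by rw [← h.value_fst x hx, h'.value_fst x hx])
    (by rw [← h.value_snd x hx, h'.value_snd x hx])

lemma familyBound_le_card_isQuartered {m : ℕ} (hm : 2 ≤ m) {f : X → ZMod 2 × ZMod 2}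
    (hf : Uniform f (2 ^ (m - 2))) (d : ZMod 2 × ZMod 2) :
    familyBound m (m - 2) ≤ Nat.card {M // IsQuartered f d M} := by
  have hJ : Fintype.card (ZMod 2) = 2 ^ (m - (m - 2) - 1) := by
    rw [ZMod.card, show m - (m - 2) - 1 = 1 by omega, pow_one]
  refine (familyBound_le_card m (m - 2) (by omega) hJ
    (p := fun i => (f i).1) (P := fun i => (f i).2) hf 0).trans ?_
  obtain ⟨s, hs⟩ := hf.exists_section (by positivity)
  let w : X → ZMod 2 := Pi.single (s d) 1 + Pi.single (s 0) 1
  have hw : ∑ i, w i = 0 := by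
    simp [w, Finset.sum_add_distrib, CharTwo.add_self_eq_zero]
  have hd : ((fun i => (f i).1) ⬝ᵥ w, (fun i => (f i).2) ⬝ᵥ w) = d := by
    simp [w, dotProduct_add, hs]
  refine Nat.card_le_card_of_injective
    (fun M => ⟨{x | x + w ∈ M.1}, hd ▸ IsTight.isQuartered M.2 hw⟩) fun M M' h => ?_
  refine Subtype.ext (Set.ext fun x => ?_)
  have := congrArg (fun S : Set (X → ZMod 2) => x + w ∈ S) (congrArg Subtype.val h)
  simpa [add_assoc, word_add_self] using this

theorem card_isExtPerfect_ge {m : ℕ} (hm : 2 ≤ m) (hX : Fintype.card X = 2 ^ m) :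
    (2 ^ m).factorial / (6 * (2 ^ m / 4).factorial ^ 4) * familyBound m (m - 2) ≤
      Nat.card {M : Set (X → ZMod 2) // IsExtPerfect M} := by
  classical
  obtain ⟨k, hk, hk4⟩ : ∃ k, k = 2 ^ (m - 2) ∧ 2 ^ m = 4 * k := by
    refine ⟨_, rfl, ?_⟩
    conv_lhs => rw [← Nat.sub_add_cancel hm, pow_add]
    ring
  have hkpos : 0 < k := by rw [hk]; positivity
  have : Nonempty X := Fintype.card_pos_iff.1 (by rw [hX]; positivity)
  obtain ⟨q, hq⟩ : ∃ q : X → ZMod 2 × ZMod 2, Uniform q k := by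
    have e : X ≃ (ZMod 2 × ZMod 2) × Fin k := Fintype.equivOfCardEq (by
      simp [hX, hk4])
    refine ⟨fun i => (e i).1, fun j => ?_⟩
    refine Eq.trans ?_ (Finset.card_fin k)
    refine Finset.card_bij' (fun i _ => (e i).2) (fun a _ => e.symm (j, a)) ?_ ?_ ?_ ?_
    · simp
    · simp
    · intro i hi
      rw [← (Finset.mem_filter.1 hi).2]; simp
    · simp
  have hmult := multinomial_le_card_uniform hq
  rw [hX, Fintype.card_prod, ZMod.card] at hmult
  have hemb : ∀ (f : {f : X → ZMod 2 × ZMod 2 // Uniform f k}) (d : ZMod 2 × ZMod 2),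
      ∃ φ : Fin (familyBound m (m - 2)) → {M : Set (X → ZMod 2) // IsQuartered f.1 d M},
        Function.Injective φ := by
    intro f d
    have hle := familyBound_le_card_isQuartered hm (fun j => (f.2 j).trans hk) d
    rw [Nat.card_eq_fintype_card] at hle
    obtain ⟨φ⟩ := Function.Embedding.nonempty_of_card_le
      ((Fintype.card_fin _).le.trans hle)
    exact ⟨φ, φ.injective⟩
  choose φ hφ using hemb
  let T := {f : X → ZMod 2 × ZMod 2 // Uniform f k} × (ZMod 2 × ZMod 2) ×
    Fin (familyBound m (m - 2))
  let Ψ : T → {M : Set (X → ZMod 2) // IsExtPerfect M} :=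
    fun a => ⟨φ a.1 a.2.1 a.2.2, (φ a.1 a.2.1 a.2.2).2.perfect⟩
  have hperm : ∀ a b : T, Ψ a = Ψ b → ∃ σ : Equiv.Perm (ZMod 2 × ZMod 2), b.1.1 = σ ∘ a.1.1 := by
    intro a b h
    have ha := (φ a.1 a.2.1 a.2.2).2
    have hb := (φ b.1 b.2.1 b.2.2).2
    rw [← show (φ a.1 a.2.1 a.2.2).1 = (φ b.1 b.2.1 b.2.2).1 from congrArg Subtype.val h] at hb
    obtain ⟨s, hs⟩ := b.1.2.exists_section hkpos
    exact ha.exists_perm hb fun c => ⟨s c, hs c⟩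
  have hfib : ∀ a b : T, Ψ a = Ψ b → a.1 = b.1 → a = b := by
    rintro ⟨f, d, i⟩ ⟨f', d', i'⟩ h hff
    dsimp only at hff
    subst hff
    have h1 : (φ f d i).1 = (φ f d' i').1 := congrArg Subtype.val h
    have hd : d = d' := (φ f d i).2.value_unique (h1.symm ▸ (φ f d' i').2)
    subst hd
    rw [hφ f d (Subtype.ext h1)]
  have hTcard := Finset.card_le_mul_card_image (s := (Finset.univ : Finset T)) (f := Ψ) 24 ?_
  · rw [Finset.card_univ] at hTcard
    have hT2 : Fintype.card T ≤ 24 * Nat.card {M : Set (X → ZMod 2) // IsExtPerfect M} := by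
      rw [Nat.card_eq_fintype_card]
      exact hTcard.trans (Nat.mul_le_mul_left _ (Finset.card_le_univ _))
    rw [show Fintype.card T = Nat.card {f : X → ZMod 2 × ZMod 2 // Uniform f k} *
      (4 * familyBound m (m - 2)) by
        simp [T, Nat.card_eq_fintype_card]] at hT2
    have hdiv : (2 ^ m).factorial / (6 * (2 ^ m / 4).factorial ^ 4) * 6 ≤
        Nat.card {f : X → ZMod 2 × ZMod 2 // Uniform f k} := by
      rw [show 2 ^ m / 4 = k by omega]
      refine Nat.le_of_mul_le_mul_right ?_ (pow_pos k.factorial_pos 4)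
      refine le_trans ?_ hmult
      rw [mul_assoc]
      exact Nat.div_mul_le_self _ _
    have := Nat.mul_le_mul_right (4 * familyBound m (m - 2)) hdiv
    nlinarith
  · intro M _
    rcases (Finset.univ.filter fun a => Ψ a = M).eq_empty_or_nonempty with h | ⟨a₀, ha₀⟩
    · rw [h]; simp
    have hcard : Fintype.card (Equiv.Perm (ZMod 2 × ZMod 2)) = 24 := by
      rw [Fintype.card_perm, Fintype.card_prod, ZMod.card]; rfl
    have h0 : ∀ a : {a // a ∈ Finset.univ.filter fun a => Ψ a = M}, Ψ a₀ = Ψ a.1 := fun a =>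
      (Finset.mem_filter.1 ha₀).2.trans (Finset.mem_filter.1 a.2).2.symm
    choose σ hσ using fun a => hperm a₀ _ (h0 a)
    rw [← hcard, ← Fintype.card_coe]
    refine Fintype.card_le_of_injective σ fun a b hab => ?_
    refine Subtype.ext (hfib _ _ ((h0 a).symm.trans (h0 b)) (Subtype.ext ?_))
    rw [hσ a, hσ b, hab]

end Quarters

section Puncture

lemma eq_or_eq_add_single_of_hammingDist_le_one {x y : X → ZMod 2} (h : hammingDist x y ≤ 1) :
    x = y ∨ ∃ i, x = y + Pi.single i 1 := by
  by_cases hxy : x = y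
  · exact Or.inl hxy
  right
  obtain ⟨i, hi⟩ := Function.ne_iff.1 hxy
  refine ⟨i, funext fun j => ?_⟩
  by_cases hj : x j = y j
  · have hji : j ≠ i := by rintro rfl; exact hi hj
    simp [hj, hji]
  · have hji : j = i := Finset.card_le_one.1 h j (by simp [hj]) i (by simp [hi])
    subst hji
    rcases eq_or_eq_add_one (x j) (y j) with h | h
    · exact absurd h hj
    · simp [h]

lemma hammingDist_add_single_le_one (y : X → ZMod 2) (i : X) :
    hammingDist (y + Pi.single i 1) y ≤ 1 := by
  refine Finset.card_le_one.2 fun a ha b hb => ?_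
  have : ∀ a, (y + Pi.single i 1 : X → ZMod 2) a ≠ y a → a = i := by
    intro a ha
    by_contra hne
    simp [hne] at ha
  rw [this a (Finset.mem_filter.1 ha).2, this b (Finset.mem_filter.1 hb).2]

/-- Extend a word by a new coordinate with value `b`. -/
def extend (b : ZMod 2) (x : X → ZMod 2) : Option X → ZMod 2 := fun o => o.elim b x

lemma sum_extend (b : ZMod 2) (x : X → ZMod 2) : ∑ o, extend b x o = b + ∑ i, x i := by
  simp [extend, Fintype.sum_option]

lemma extend_add_single_none (b : ZMod 2) (x : X → ZMod 2) :
    extend b x + Pi.single none 1 = extend (b + 1) x := by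
  ext o; cases o <;> simp [extend]

lemma extend_add_single_some (b : ZMod 2) (x : X → ZMod 2) (i : X) :
    extend b x + Pi.single (some i) 1 = extend b (x + Pi.single i 1) := by
  ext o; cases o <;> simp [extend, Pi.single_apply]

/-- The code obtained by deleting the coordinate `none`. -/
def puncture (M : Set (Option X → ZMod 2)) : Set (X → ZMod 2) :=
  {x | extend (∑ i, x i) x ∈ M}

lemma puncture_injOn {M M' : Set (Option X → ZMod 2)} (hM : IsExtPerfect M)
    (hM' : IsExtPerfect M') (h : puncture M = puncture M') : M = M' := by
  have key : ∀ M : Set (Option X → ZMod 2), IsExtPerfect M → ∀ x, x ∈ M ↔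
      ∑ o, x o = 0 ∧ (fun i => x (some i)) ∈ puncture M := by
    intro M hM x
    have hx : ∑ o, x o = 0 → extend (∑ i, x (some i)) (fun i => x (some i)) = x := by
      intro h0
      rw [Fintype.sum_option] at h0
      ext o
      cases o
      · exact (CharTwo.add_eq_zero.1 h0).symm
      · rfl
    constructor
    · intro h
      exact ⟨hM.1 x h, by change extend _ _ ∈ M; rwa [hx (hM.1 x h)]⟩
    · rintro ⟨h0, h⟩
      rw [← hx h0]; exact h
  ext x
  rw [key M hM, key M' hM', h]

lemma perfect_puncture {M : Set (Option X → ZMod 2)} (hM : IsExtPerfect M) (y : X → ZMod 2) :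
    ∃! x, x ∈ puncture M ∧ hammingDist x y ≤ 1 := by
  have h0 : ∀ o, extend (∑ i, y i + 1) y + Pi.single o 1 ∈ M ↔
      o.elim y (fun i => y + Pi.single i 1) ∈ puncture M := by
    intro o
    cases o with
    | none =>
      rw [extend_add_single_none, add_assoc, CharTwo.add_self_eq_zero, add_zero]; rfl
    | some i =>
      rw [extend_add_single_some]
      simp [puncture, Finset.sum_add_distrib]
  obtain ⟨o, ho, huniq⟩ := hM.2 (extend (∑ i, y i + 1) y) (by
    rw [sum_extend, add_right_comm, CharTwo.add_self_eq_zero, zero_add])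
  refine ⟨o.elim y (fun i => y + Pi.single i 1), ⟨(h0 o).1 ho, ?_⟩, ?_⟩
  · cases o with
    | none => simp
    | some i => exact hammingDist_add_single_le_one y i
  · rintro x ⟨hx, hxy⟩
    rcases eq_or_eq_add_single_of_hammingDist_le_one hxy with rfl | ⟨i, rfl⟩
    · rw [← huniq none ((h0 none).2 hx)]; rfl
    · rw [← huniq (some i) ((h0 (some i)).2 hx)]; rfl

end Puncture

end ColumnCode

/-- lower bound on B(n-1), the number of 1-perfect binary codes of
length n-1 = 2^m - 1. -/
theorem stmt_17 (m : ℕ) (hm : 4 ≤ m) :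
    Nat.card {C : Set (Word (2 ^ m - 1)) // Perfect1 C} ≥
      (Nat.factorial (2 ^ m) / (6 * (Nat.factorial (2 ^ m / 4)) ^ 4)) *
        ∏ t ∈ Finset.Icc 1 (m - 2),
          ((Dfac m t) ^ (Wfac m (t + 1)) - (Dfac m t) * (Wfac m (t + 1))) ^
            (∏ i ∈ Finset.Icc (t + 2) (m - 1), Wfac m i) := by
  have hX : Fintype.card (Option (Fin (2 ^ m - 1))) = 2 ^ m := by
    rw [Fintype.card_option, Fintype.card_fin, Nat.sub_add_cancel Nat.one_le_two_pow]
  have h := ColumnCode.card_isExtPerfect_ge (m := m) (by omega) hX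
  have hbound : ColumnCode.familyBound m (m - 2) = ∏ t ∈ Finset.Icc 1 (m - 2),
      ((Dfac m t) ^ (Wfac m (t + 1)) - (Dfac m t) * (Wfac m (t + 1))) ^
        (∏ i ∈ Finset.Icc (t + 2) (m - 1), Wfac m i) := by
    rw [ColumnCode.familyBound, show m - 2 + 1 = m - 1 by omega]
  rw [hbound] at h
  refine h.trans (Nat.card_le_card_of_injective
    (fun M => ⟨ColumnCode.puncture M.1, ColumnCode.perfect_puncture M.2⟩) fun M M' hMM => ?_)
  exact Subtype.ext (ColumnCode.puncture_injOn M.2 M'.2 (congrArg Subtype.val hMM))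
end
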